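/- arXiv:1502.01870 — 3 statements merged into one kernel-verified Lean document; each statement's English description precedes it below -/
import Mathlib

section
/- Let n = 2, ν > 0, K = √ν·(I₂ ⊕ diag(1,−1)) (the 4×4 block-diagonal matrix with blocks √ν·I₂ and √ν·diag(1,−1)), and α = I₄. Then the pair (K, α) satisfies the positivity condition, but there do not exist a real number λ ≥ 1 and a real 4×4 matrix K' such that (K = λ·K' or K = λ·K'·T) and the pair (K', I₄) satisfies the CP condition. (Hence this Gaussian-to-Gaussian map cannot be written as a dilatation, possibly composed with the total transposition, followed by a completely positive map.) -/
open Matrix Complex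
open scoped ComplexOrder

/-- The standard symplectic form for two modes. -/
noncomputable def Δ₄ : Matrix (Fin 4) (Fin 4) ℝ :=
  !![0, 1, 0, 0; -1, 0, 0, 0; 0, 0, 0, 1; 0, 0, -1, 0]

/-- The two-mode total transposition `diag(1,-1,1,-1)`. -/
noncomputable def T₄ : Matrix (Fin 4) (Fin 4) ℝ :=
  !![1, 0, 0, 0; 0, -1, 0, 0; 0, 0, 1, 0; 0, 0, 0, -1]

/-- `σ ≥ ± iΔ` : both `σ + iΔ` and `σ - iΔ` (as complex matrices) are PSD. -/
noncomputable def GeqPMiDelta (σ : Matrix (Fin 4) (Fin 4) ℝ) : Prop :=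
  (σ.map (Complex.ofReal) + Complex.I • Δ₄.map (Complex.ofReal)).PosSemidef ∧
  (σ.map (Complex.ofReal) - Complex.I • Δ₄.map (Complex.ofReal)).PosSemidef

/-- A quantum covariance matrix: real symmetric with `σ ≥ ± iΔ`. -/
noncomputable def IsQCM (σ : Matrix (Fin 4) (Fin 4) ℝ) : Prop :=
  σ.IsSymm ∧ GeqPMiDelta σ

/-- The positivity condition: `K σ Kᵀ + α ≥ ± iΔ` for every quantum covariance matrix `σ`. -/
noncomputable def PosCond (K α : Matrix (Fin 4) (Fin 4) ℝ) : Prop :=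
  ∀ σ : Matrix (Fin 4) (Fin 4) ℝ, IsQCM σ → GeqPMiDelta (K * σ * Kᵀ + α)

/-- The CP condition: both `α + i(Δ - KΔKᵀ)` and `α - i(Δ - KΔKᵀ)` are PSD. -/
noncomputable def CPCond (K α : Matrix (Fin 4) (Fin 4) ℝ) : Prop :=
  (α.map (Complex.ofReal) + Complex.I • ((Δ₄ - K * Δ₄ * Kᵀ).map (Complex.ofReal))).PosSemidef ∧
  (α.map (Complex.ofReal) - Complex.I • ((Δ₄ - K * Δ₄ * Kᵀ).map (Complex.ofReal))).PosSemidef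

theorem posSemidef_one_add_I_smul_symplectic :
    ((1 : Matrix (Fin 4) (Fin 4) ℝ).map Complex.ofReal +
      Complex.I • Δ₄.map Complex.ofReal).PosSemidef := by
  convert Matrix.posSemidef_conjTranspose_mul_self
    (!![1, Complex.I, 0, 0; 0, 0, 1, Complex.I] : Matrix (Fin 2) (Fin 4) ℂ) using 1
  ext i j
  fin_cases i <;> fin_cases j <;> simp [Δ₄, Matrix.mul_apply, Fin.sum_univ_succ]

theorem posSemidef_one_sub_I_smul_symplectic :
    ((1 : Matrix (Fin 4) (Fin 4) ℝ).map Complex.ofReal -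
      Complex.I • Δ₄.map Complex.ofReal).PosSemidef := by
  convert Matrix.posSemidef_conjTranspose_mul_self
    (!![1, -Complex.I, 0, 0; 0, 0, 1, -Complex.I] : Matrix (Fin 2) (Fin 4) ℂ) using 1
  ext i j
  fin_cases i <;> fin_cases j <;> simp [Δ₄, Matrix.mul_apply, Fin.sum_univ_succ]

/-- A matrix satisfying the uncertainty relation is positive semidefinite. -/
theorem GeqPMiDelta.posSemidef_map {σ : Matrix (Fin 4) (Fin 4) ℝ} (h : GeqPMiDelta σ) :
    (σ.map Complex.ofReal).PosSemidef := by
  have hs := (h.1.add h.2).smul (show (0 : ℂ) ≤ 1 / 2 by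
    rw [Complex.le_def]; norm_num)
  convert hs using 1
  ext i j
  simp
  ring

/-- With vacuum noise, every linear map of phase space satisfies the positivity condition. -/
theorem posCond_one (K : Matrix (Fin 4) (Fin 4) ℝ) : PosCond K 1 := by
  intro σ hσ
  have hK : ((K * σ * Kᵀ).map Complex.ofReal).PosSemidef := by
    convert hσ.2.posSemidef_map.mul_mul_conjTranspose_same (K.map Complex.ofReal) using 1
    ext i j
    simp [Matrix.mul_apply]
  have hadd : (K * σ * Kᵀ + 1).map Complex.ofReal =
      (K * σ * Kᵀ).map Complex.ofReal + (1 : Matrix (Fin 4) (Fin 4) ℝ).map Complex.ofReal :=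
    Matrix.map_add _ Complex.ofReal_add _ _
  unfold GeqPMiDelta
  rw [hadd, add_assoc, add_sub_assoc]
  exact ⟨hK.add posSemidef_one_add_I_smul_symplectic,
    hK.add posSemidef_one_sub_I_smul_symplectic⟩

/-- The CP condition with vacuum noise bounds the antisymmetric parts of the two diagonal blocks
of `Δ - KΔKᵀ`. -/
theorem CPCond.block_sub_le_two {K : Matrix (Fin 4) (Fin 4) ℝ} (h : CPCond K 1) :
    (Δ₄ - K * Δ₄ * Kᵀ) 0 1 - (Δ₄ - K * Δ₄ * Kᵀ) 1 0 ≤ 2 ∧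
    (Δ₄ - K * Δ₄ * Kᵀ) 2 3 - (Δ₄ - K * Δ₄ * Kᵀ) 3 2 ≤ 2 := by
  have h1 := h.1
  generalize Δ₄ - K * Δ₄ * Kᵀ = M at h1 ⊢
  constructor
  · have := (Complex.le_def.1 (h1.dotProduct_mulVec_nonneg ![1, Complex.I, 0, 0])).1
    simp [Matrix.mulVec, dotProduct, Fin.sum_univ_succ] at this
    linarith
  · have := (Complex.le_def.1 (h1.dotProduct_mulVec_nonneg ![0, 0, 1, Complex.I])).1
    simp [Matrix.mulVec, dotProduct, Fin.sum_univ_succ] at this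
    linarith

/-- The partial transposition of the second mode composed with a dilatation of `√ν`,
with vacuum noise added, satisfies the positivity condition but cannot be written as
a dilatation, possibly composed with the total transposition, followed by a CP map. -/
theorem stmt16 (ν : ℝ) (hν : 0 < ν) :
    PosCond (Real.sqrt ν • !![1, 0, 0, 0; 0, 1, 0, 0; 0, 0, 1, 0; 0, 0, 0, -1]) 1 ∧
    ¬ ∃ l : ℝ, 1 ≤ l ∧ ∃ K' : Matrix (Fin 4) (Fin 4) ℝ,
        (Real.sqrt ν • !![1, 0, 0, 0; 0, 1, 0, 0; 0, 0, 1, 0; 0, 0, 0, -1] = l • K' ∨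
         Real.sqrt ν • !![1, 0, 0, 0; 0, 1, 0, 0; 0, 0, 1, 0; 0, 0, 0, -1] = l • (K' * T₄)) ∧
        CPCond K' 1 := by
  refine ⟨posCond_one _, ?_⟩
  rintro ⟨l, hl, K', hK, hcp⟩
  have hl0 : l ≠ 0 := by positivity
  have hpos : 0 < (l⁻¹ * Real.sqrt ν) * (l⁻¹ * Real.sqrt ν) := by positivity
  have hblock := hcp.block_sub_le_two
  rcases hK with hK | hK
  · have hK' : K' = (l⁻¹ * Real.sqrt ν) •
        !![1, 0, 0, 0; 0, 1, 0, 0; 0, 0, 1, 0; 0, 0, 0, -1] := by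
      rw [mul_smul, hK, smul_smul, inv_mul_cancel₀ hl0, one_smul]
    have h2 := hblock.2
    rw [hK'] at h2
    generalize l⁻¹ * Real.sqrt ν = c at h2 hpos
    simp [Δ₄, Matrix.vecMul, dotProduct, Fin.sum_univ_succ] at h2
    linarith
  · have hT : T₄ * T₄ = 1 := by
      ext i j
      fin_cases i <;> fin_cases j <;> simp [T₄, Matrix.mul_apply, Fin.sum_univ_succ]
    have hK' : K' = (l⁻¹ * Real.sqrt ν) •
        (!![1, 0, 0, 0; 0, 1, 0, 0; 0, 0, 1, 0; 0, 0, 0, -1] * T₄) := by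
      rw [← Matrix.smul_mul, mul_smul, hK, smul_smul, inv_mul_cancel₀ hl0, one_smul,
        Matrix.mul_assoc, hT, Matrix.mul_one]
    have h1 := hblock.1
    rw [hK'] at h1
    generalize l⁻¹ * Real.sqrt ν = c at h1 hpos
    simp [Δ₄, T₄, Matrix.vecMul, dotProduct, Fin.sum_univ_succ] at h1
    linarith
end

section
/- Let n = 2, and for a real number ν let Δ_K(ν) be the 4×4 real antisymmetric matrix whose only nonzero entries are (Δ_K)₁₄ = (Δ_K)₂₃ = ν and (Δ_K)₃₂ = (Δ_K)₄₁ = −ν (this equals KΔKᵀ for K = √ν·M, where M is the 4×4 matrix with rows (0,0,1,0), (0,−1,0,0), (1,0,0,0), (0,0,0,1), i.e. the partial transposition of the first mode composed with the exchange of Q¹ and Q² and a dilatation). Then for every real ν ≠ 0, the complex matrices I₄ + i(Δ − Δ_K(ν)) and I₄ − i(Δ − Δ_K(ν)) are not both positive semidefinite; equivalently the pair (K, I₄) does not satisfy the CP condition (indeed the Hermitian matrix i(Δ − Δ_K(ν)) has eigenvalues ±√(1+ν²)). -/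
open Matrix Complex
open scoped ComplexOrder

/-- `Δ_K(ν)` for the partial transposition of the first mode composed with the
exchange of `Q¹` and `Q²` and a dilatation. -/
noncomputable def ΔKex (ν : ℝ) : Matrix (Fin 4) (Fin 4) ℝ :=
  !![0, 0, 0, ν; 0, 0, ν, 0; 0, -ν, 0, 0; -ν, 0, 0, 0]

/-- For every `ν ≠ 0`, the matrices `I₄ ± i(Δ - Δ_K(ν))` are not both PSD. -/
theorem stmt17 (ν : ℝ) (hν : ν ≠ 0) :
    ¬ (((1 : Matrix (Fin 4) (Fin 4) ℂ) +
          Complex.I • ((Δ₄ - ΔKex ν).map (Complex.ofReal))).PosSemidef ∧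
       ((1 : Matrix (Fin 4) (Fin 4) ℂ) -
          Complex.I • ((Δ₄ - ΔKex ν).map (Complex.ofReal))).PosSemidef) := by
  rintro ⟨h, -⟩
  have hq := (Complex.le_def.mp (h.dotProduct_mulVec_nonneg ![-Complex.I, 1, -Complex.I * ν, 0])).1
  simp [Δ₄, ΔKex, Matrix.mulVec, dotProduct, Fin.sum_univ_four, Matrix.one_apply] at hq
  nlinarith [sq_pos_of_ne_zero hν]
end

section
/- Let n = 2, ν > 0, K = √ν·M where M is the 4×4 matrix with rows (0,0,1,0), (0,−1,0,0), (1,0,0,0), (0,0,0,1), and α = I₄. Then the pair (K, α) satisfies the positivity condition, but there do not exist a real number λ ≥ 1 and a real 4×4 matrix K' such that (K = λ·K' or K = λ·K'·T) and the pair (K', I₄) satisfies the CP condition. (Hence this Gaussian-to-Gaussian map cannot be written as a dilatation, possibly composed with the total transposition, followed by a completely positive map.) -/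
open Matrix Complex
open scoped ComplexOrder

theorem posSemidef_one_add_of_mul_self_eq_one {n : Type*} [Fintype n] [DecidableEq n]
    {B : Matrix n n ℂ} (hB : B.IsHermitian) (hsq : B * B = 1) : (1 + B).PosSemidef := by
  have h : (1 + B) = (1 / 2 : ℝ) • ((1 + B) * (1 + B)ᴴ) := by
    rw [conjTranspose_add, conjTranspose_one, hB.eq]
    have : (1 + B) * (1 + B) = (2 : ℝ) • (1 + B) := by
      rw [add_mul, mul_add, mul_add, hsq, two_smul]
      simp only [one_mul, mul_one]
      abel
    rw [this, smul_smul]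
    norm_num
  rw [h]
  exact (posSemidef_self_mul_conjTranspose (1 + B)).smul (by norm_num)

theorem isHermitian_I_smul_symplectic :
    (Complex.I • Δ₄.map Complex.ofReal).IsHermitian := by
  ext i j
  fin_cases i <;> fin_cases j <;> simp [Δ₄]

theorem I_smul_symplectic_mul_self :
    (Complex.I • Δ₄.map Complex.ofReal) * (Complex.I • Δ₄.map Complex.ofReal) = 1 := by
  ext i j
  fin_cases i <;> fin_cases j <;> simp [Δ₄, Matrix.mul_apply, Fin.sum_univ_four]

theorem IsQCM.posSemidef {σ : Matrix (Fin 4) (Fin 4) ℝ} (h : IsQCM σ) :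
    (σ.map Complex.ofReal).PosSemidef := by
  have hσ : σ.map Complex.ofReal = (1 / 2 : ℝ) •
      ((σ.map Complex.ofReal + Complex.I • Δ₄.map Complex.ofReal) +
        (σ.map Complex.ofReal - Complex.I • Δ₄.map Complex.ofReal)) := by
    rw [add_add_sub_cancel, ← two_smul ℝ (σ.map Complex.ofReal), smul_smul]
    norm_num
  rw [hσ]
  exact (h.2.1.add h.2.2).smul (by norm_num)

theorem not_cpCond_one {K : Matrix (Fin 4) (Fin 4) ℝ} {c : ℝ} (hc : c ≠ 0)
    (hK : K * Δ₄ * Kᵀ = c • !![0, 0, 0, 1; 0, 0, 1, 0; 0, -1, 0, 0; -1, 0, 0, 0]) :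
    ¬ CPCond K 1 := by
  rintro ⟨h, -⟩
  rw [hK] at h
  have hv := h.dotProduct_mulVec_nonneg ![1, Complex.I, 0, -(Complex.I * c)]
  have hre := (Complex.le_def.1 hv).1
  simp [Δ₄, Matrix.mulVec, dotProduct, Fin.sum_univ_four, Matrix.one_apply] at hre
  have := mul_self_pos.2 hc
  nlinarith

/-- The `Q`-exchange example: `K = √ν · M` with `M` the partial transposition of the
first mode composed with the exchange of `Q¹` and `Q²`, and `α = I₄`, satisfies the
positivity condition but cannot be written as a dilatation, possibly composed with
the total transposition, followed by a CP map. -/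
theorem stmt18 (ν : ℝ) (hν : 0 < ν) :
    PosCond (Real.sqrt ν • !![0, 0, 1, 0; 0, -1, 0, 0; 1, 0, 0, 0; 0, 0, 0, 1]) 1 ∧
    ¬ ∃ l : ℝ, 1 ≤ l ∧ ∃ K' : Matrix (Fin 4) (Fin 4) ℝ,
        (Real.sqrt ν • !![0, 0, 1, 0; 0, -1, 0, 0; 1, 0, 0, 0; 0, 0, 0, 1] = l • K' ∨
         Real.sqrt ν • !![0, 0, 1, 0; 0, -1, 0, 0; 1, 0, 0, 0; 0, 0, 0, 1] = l • (K' * T₄)) ∧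
        CPCond K' 1 := by
  refine ⟨posCond_one _, ?_⟩
  rintro ⟨l, hl, K', hK, hCP⟩
  have hl0 : l ≠ 0 := by positivity
  have hc : l⁻¹ * Real.sqrt ν ≠ 0 := mul_ne_zero (inv_ne_zero hl0) (Real.sqrt_pos.2 hν).ne'
  generalize hd : l⁻¹ * Real.sqrt ν = c at hc
  rcases hK with hK | hK
  · have hK' : K' = c • !![0, 0, 1, 0; 0, -1, 0, 0; 1, 0, 0, 0; 0, 0, 0, 1] := by
      rw [← hd, mul_smul, hK, inv_smul_smul₀ hl0]
    refine not_cpCond_one (c := c * c) (mul_ne_zero hc hc) ?_ hCP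
    rw [hK']
    ext i j
    fin_cases i <;> fin_cases j <;> simp [Δ₄, Matrix.mul_apply, Fin.sum_univ_four]
  · have hT : T₄ * T₄ = 1 := by
      ext i j
      fin_cases i <;> fin_cases j <;> simp [T₄, Matrix.mul_apply, Fin.sum_univ_four]
    have hK' : K' = c • (!![0, 0, 1, 0; 0, -1, 0, 0; 1, 0, 0, 0; 0, 0, 0, 1] * T₄) := by
      rw [← smul_mul_assoc, ← hd, mul_smul, hK, inv_smul_smul₀ hl0, mul_assoc, hT, mul_one]
    refine not_cpCond_one (c := -(c * c)) (neg_ne_zero.2 (mul_ne_zero hc hc)) ?_ hCP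
    rw [hK']
    ext i j
    fin_cases i <;> fin_cases j <;> simp [Δ₄, T₄, Matrix.mul_apply, Fin.sum_univ_four]
end
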